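/- arXiv:1604.01593 — 2 statements merged into one kernel-verified Lean document; each statement's English description precedes it below -/
import Mathlib

section
/- For every λ ∈ ℂ \ {0}, α ∈ ℂ and every finitely supported sequence (h^{(i)})_{i≥0} of complex numbers, the linear operators L_m, W_m (m ∈ ℤ) on ℂ[s,t] defining Φ(λ,α,h) for b = 1 satisfy L_m∘L_n − L_n∘L_m = (n−m)L_{m+n}, L_m∘W_n − W_n∘L_m = (n+m)W_{m+n}, and W_m∘W_n − W_n∘W_m = 0 for all m, n ∈ ℤ; hence Φ(λ,α,h) is a module over the Lie algebra W(0,1). -/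
open MvPolynomial

noncomputable section

/-- The polynomial ring `ℂ[s,t]`, realized as `MvPolynomial (Fin 2) ℂ`
with `s = X 0` and `t = X 1`. -/
abbrev R2 : Type := MvPolynomial (Fin 2) ℂ

/-- The substitution `f(s,t) ↦ f(s-m,t)`, as a `ℂ`-linear map on `ℂ[s,t]`. -/
def shiftS (m : ℤ) : R2 →ₗ[ℂ] R2 :=
  (aeval (fun i : Fin 2 => if i = 0 then (X 0 - C (m : ℂ) : R2) else (X 1 : R2))).toLinearMap

/-- Multiplication by a fixed polynomial, as a `ℂ`-linear map. -/
def mulBy (p : R2) : R2 →ₗ[ℂ] R2 := LinearMap.mulLeft ℂ p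

/-- The partial derivative `∂/∂t`, as a `ℂ`-linear map. -/
def dT : R2 →ₗ[ℂ] R2 := (pderiv (1 : Fin 2)).toLinearMap

/-- Kronecker delta on `ℂ`. -/
def dlt (x y : ℂ) : ℂ := if x = y then 1 else 0

/-- `q_{n,k;α}(t) = n t^k − δ_{b,−1} n(n−1)α Σ_{j=0}^{k−1} α^{k−1−j} t^j
− δ_{b,1} n α Σ_{j=0}^{k−1} α^{k−1−j} t^j`. -/
def qpoly (b α : ℂ) (n : ℤ) (k : ℕ) : R2 :=
  (n : ℂ) • ((X 1 : R2) ^ k)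
    - (dlt b (-1) * (n : ℂ) * ((n : ℂ) - 1) * α) •
        ∑ j ∈ Finset.range k, (C (α ^ (k - 1 - j)) * (X 1 : R2) ^ j)
    - (dlt b 1 * (n : ℂ) * α) •
        ∑ j ∈ Finset.range k, (C (α ^ (k - 1 - j)) * (X 1 : R2) ^ j)

/-- `h_n(t) = Σ_i h^{(i)} q_{n,i;α}(t)` for a finitely supported sequence `h`. -/
def hpol (b α : ℂ) (h : ℕ →₀ ℂ) (n : ℤ) : R2 := h.sum fun i c => c • qpoly b α n i

/-- The polynomial `t − δ_{b,−1} mα − δ_{b,1}(1−δ_{m,0})α`. -/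
def wcoef (b α : ℂ) (m : ℤ) : R2 :=
  X 1 - C (dlt b (-1) * (m : ℂ) * α + dlt b 1 * (if m = 0 then 0 else 1) * α)

/-- The operator `W_m` of the module `Φ(λ,α,h)`:
`W_m · f(s,t) = λ^m (t − δ_{b,−1} mα − δ_{b,1}(1−δ_{m,0})α) f(s−m,t)`. -/
def PhiW (b lam α : ℂ) (m : ℤ) : R2 →ₗ[ℂ] R2 :=
  mulBy (C (lam ^ m) * wcoef b α m) ∘ₗ shiftS m

/-- The operator `L_m` of the module `Φ(λ,α,h)`:
`L_m · f(s,t) = λ^m (s + h_m(t)) f(s−m,t)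
 + b m λ^m (t − δ_{b,−1} mα − δ_{b,1}(1−δ_{m,0})α) (∂f/∂t)(s−m,t)`. -/
def PhiL (b lam α : ℂ) (h : ℕ →₀ ℂ) (m : ℤ) : R2 →ₗ[ℂ] R2 :=
  mulBy (C (lam ^ m) * (X 0 + hpol b α h m)) ∘ₗ shiftS m
    + (b * (m : ℂ) * lam ^ m) • (mulBy (wcoef b α m) ∘ₗ (shiftS m ∘ₗ dT))

/-- `r_m(t) = Σ_i r^{(i)} m t^i` for a finitely supported sequence `r`. -/
def rpol (r : ℕ →₀ ℂ) (m : ℤ) : R2 := r.sum fun i c => (c * (m : ℂ)) • ((X 1 : R2) ^ i)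

/-- The operator `L_m` of the module `Θ(λ,r)`:
`L_m · f(s,t) = λ^m (s + r_m(t)) f(s−m,t)`. -/
def ThetaL (lam : ℂ) (r : ℕ →₀ ℂ) (m : ℤ) : R2 →ₗ[ℂ] R2 :=
  mulBy (C (lam ^ m) * (X 0 + rpol r m)) ∘ₗ shiftS m

/-- The operator `W_m` of the module `Θ(λ,r)`: `W_m · f(s,t) = δ_{m,0} t f(s,t)`. -/
def ThetaW (m : ℤ) : R2 →ₗ[ℂ] R2 := if m = 0 then mulBy (X 1) else 0

/-- The common factor `g` in `h_n(t) = n g(t)`, for `b = 1`. -/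
def hfactor (α : ℂ) (h : ℕ →₀ ℂ) : R2 :=
  h.sum fun i c =>
    C c * (X 1 ^ i - C α * ∑ j ∈ Finset.range i, (C (α ^ (i - 1 - j)) * (X 1 : R2) ^ j))

lemma dlt_self (x : ℂ) : dlt x x = 1 := if_pos rfl

lemma dlt_one_neg_one : dlt 1 (-1) = 0 := if_neg (by norm_num)

lemma hpol_one (α : ℂ) (h : ℕ →₀ ℂ) (n : ℤ) : hpol 1 α h n = C (n : ℂ) * hfactor α h := by
  simp only [hpol, hfactor, Finsupp.sum, Finset.mul_sum]
  refine Finset.sum_congr rfl fun i _ => ?_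
  simp only [qpoly, dlt_one_neg_one, dlt_self, smul_eq_C_mul, ← Finset.mul_sum, C_mul, C_0, C_1]
  ring

lemma shiftS_mul (m : ℤ) (p q : R2) : shiftS m (p * q) = shiftS m p * shiftS m q := by
  simp [shiftS]

lemma shiftS_C (m : ℤ) (a : ℂ) : shiftS m (C a) = C a := by
  simp only [shiftS, AlgHom.toLinearMap_apply, algHom_C, algebraMap_eq]

lemma shiftS_one (m : ℤ) : shiftS m 1 = 1 := by
  rw [← C_1, shiftS_C]

lemma shiftS_X_zero (m : ℤ) : shiftS m (X 0) = X 0 - C (m : ℂ) := by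
  simp [shiftS]

lemma shiftS_X_one (m : ℤ) : shiftS m (X 1) = X 1 := by
  simp [shiftS]

lemma shiftS_hfactor (m : ℤ) (α : ℂ) (h : ℕ →₀ ℂ) :
    shiftS m (hfactor α h) = hfactor α h := by
  simp only [hfactor, Finsupp.sum, shiftS, AlgHom.toLinearMap_apply, map_sum, map_mul, map_sub,
    map_pow, algHom_C, aeval_X, algebraMap_eq]
  simp

lemma shiftS_wcoef (m n : ℤ) (b α : ℂ) : shiftS m (wcoef b α n) = wcoef b α n := by
  simp only [wcoef, map_sub, shiftS_C, shiftS_X_one]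

lemma shiftS_shiftS (m n : ℤ) (f : R2) : shiftS m (shiftS n f) = shiftS (m + n) f := by
  induction f using MvPolynomial.induction_on with
  | C a => simp only [shiftS_C]
  | add p q hp hq => simp only [map_add, hp, hq]
  | mul_X p i hp =>
    fin_cases i
    · simp only [shiftS_mul, hp, Fin.zero_eta, shiftS_X_zero, map_sub, shiftS_C, Int.cast_add,
        C_add]
      ring
    · simp only [shiftS_mul, hp, Fin.mk_one, shiftS_X_one]

lemma dT_mul (p q : R2) : dT (p * q) = dT p * q + p * dT q := by
  simp [dT, Derivation.leibniz]
  ring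

lemma dT_C (a : ℂ) : dT (C a) = 0 := by simp [dT]

lemma dT_X_zero : dT (X 0) = 0 := by simp [dT]

lemma dT_X_one : dT (X 1) = 1 := by simp [dT]

lemma dT_wcoef (b α : ℂ) (m : ℤ) : dT (wcoef b α m) = 1 := by
  simp only [wcoef, map_sub, dT_X_one, dT_C, sub_zero]

lemma dT_shiftS (m : ℤ) (f : R2) : dT (shiftS m f) = shiftS m (dT f) := by
  induction f using MvPolynomial.induction_on with
  | C a => simp only [shiftS_C, dT_C, map_zero]
  | add p q hp hq => simp only [map_add, hp, hq]
  | mul_X p i hp =>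
    fin_cases i
    · simp only [shiftS_mul, dT_mul, hp, Fin.zero_eta, shiftS_X_zero, map_sub, dT_X_zero, dT_C,
        map_add, map_zero, sub_zero]
    · simp only [shiftS_mul, dT_mul, hp, Fin.mk_one, shiftS_X_one, dT_X_one, map_add]
      rw [shiftS_one]

lemma shiftS_dT_hfactor (m : ℤ) (α : ℂ) (h : ℕ →₀ ℂ) :
    shiftS m (dT (hfactor α h)) = dT (hfactor α h) := by
  rw [← dT_shiftS, shiftS_hfactor]

lemma wcoef_one (α : ℂ) (m : ℤ) : wcoef 1 α m = X 1 - C (if m = 0 then 0 else α) := by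
  simp only [wcoef, dlt_one_neg_one, dlt_self]
  split_ifs <;> simp

lemma mul_wcoef_comm (α : ℂ) (m n : ℤ) :
    C (m : ℂ) * C (n : ℂ) * wcoef 1 α m = C (m : ℂ) * C (n : ℂ) * wcoef 1 α n := by
  by_cases hm : m = 0
  · simp [hm]
  by_cases hn : n = 0
  · simp [hn]
  simp only [wcoef_one, hm, hn]

lemma wcoef_weighted_sum (α : ℂ) (m n : ℤ) :
    C (m : ℂ) * wcoef 1 α m + C (n : ℂ) * wcoef 1 α n
      = (C (m : ℂ) + C (n : ℂ)) * wcoef 1 α (m + n) := by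
  by_cases hm : m = 0
  · simp [hm]
  by_cases hn : n = 0
  · simp [hn]
  by_cases hmn : m + n = 0
  · obtain rfl : n = -m := by omega
    simp [wcoef_one, hm]
  simp only [wcoef_one, hm, hn, hmn, if_false]
  ring

lemma PhiW_one_apply (lam α : ℂ) (m : ℤ) (f : R2) :
    PhiW 1 lam α m f = C (lam ^ m) * wcoef 1 α m * shiftS m f := rfl

lemma PhiL_one_apply (lam α : ℂ) (h : ℕ →₀ ℂ) (m : ℤ) (f : R2) :
    PhiL 1 lam α h m f = C (lam ^ m) * ((X 0 + C (m : ℂ) * hfactor α h) * shiftS m f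
      + C (m : ℂ) * wcoef 1 α m * shiftS m (dT f)) := by
  simp only [PhiL, mulBy, hpol_one, LinearMap.add_apply, LinearMap.comp_apply,
    LinearMap.smul_apply, LinearMap.mulLeft_apply, smul_eq_C_mul, C_mul, C_1]
  ring

/-- the operators defining `Φ(λ,α,h)` for `b = 1` satisfy the defining
relations of the Lie algebra `W(0,1)`, so `Φ(λ,α,h)` is a `W(0,1)`-module. -/
theorem stmt2 (lam : ℂ) (hlam : lam ≠ 0) (α : ℂ) (h : ℕ →₀ ℂ) :
    (∀ m n : ℤ,
      PhiL 1 lam α h m ∘ₗ PhiL 1 lam α h n - PhiL 1 lam α h n ∘ₗ PhiL 1 lam α h m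
        = ((n : ℂ) - (m : ℂ)) • PhiL 1 lam α h (m + n)) ∧
    (∀ m n : ℤ,
      PhiL 1 lam α h m ∘ₗ PhiW 1 lam α n - PhiW 1 lam α n ∘ₗ PhiL 1 lam α h m
        = ((n : ℂ) + (m : ℂ)) • PhiW 1 lam α (m + n)) ∧
    (∀ m n : ℤ,
      PhiW 1 lam α m ∘ₗ PhiW 1 lam α n - PhiW 1 lam α n ∘ₗ PhiW 1 lam α m = 0) := by
  refine ⟨fun m n => LinearMap.ext fun f => ?_, fun m n => LinearMap.ext fun f => ?_,
    fun m n => LinearMap.ext fun f => ?_⟩ <;>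
  simp only [LinearMap.sub_apply, LinearMap.comp_apply, LinearMap.smul_apply,
    LinearMap.zero_apply, PhiW_one_apply, PhiL_one_apply, smul_eq_C_mul, zpow_add₀ hlam, map_add,
    map_sub, shiftS_mul, dT_mul, dT_shiftS, shiftS_shiftS, shiftS_C, shiftS_X_zero,
    shiftS_hfactor, shiftS_wcoef, shiftS_dT_hfactor,
    shiftS_one, dT_C, dT_X_zero, dT_wcoef, map_zero, zero_mul, C_mul, Int.cast_add, add_comm n m]
  · have h1 := mul_wcoef_comm α m n
    have h2 := wcoef_weighted_sum α m n
    linear_combination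
      (C (lam ^ m) * C (lam ^ n) * dT (hfactor α h) * shiftS (m + n) f) * h1
        + (C (lam ^ m) * C (lam ^ n) * (C (n : ℂ) - C (m : ℂ)) * shiftS (m + n) (dT f)) * h2
  · have h2 := wcoef_weighted_sum α m n
    linear_combination (C (lam ^ m) * C (lam ^ n) * shiftS (m + n) f) * h2
  · ring
end
end

section
/- Let λ, μ ∈ ℂ \ {0}, α, β ∈ ℂ and let (h^{(i)})_{i≥0}, (e^{(i)})_{i≥0} be finitely supported sequences of complex numbers, with associated polynomials h_n, e_n. Then the W(0,−1)-modules Φ(λ,α,h) and Φ(μ,β,e) are isomorphic if and only if λ = μ, α = β, and h_n = e_n for all n ∈ ℤ. -/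
open MvPolynomial

noncomputable section

/-- A linear endomorphism of a polynomial ring commuting with the multiplications by the variables
is the multiplication by its value at `1`. -/
theorem MvPolynomial.linearMap_eq_mul_of_map_X_mul {σ R : Type*} [CommSemiring R]
    (φ : MvPolynomial σ R →ₗ[R] MvPolynomial σ R) (hφ : ∀ i f, φ (X i * f) = X i * φ f)
    (f : MvPolynomial σ R) : φ f = f * φ 1 := by
  induction f using MvPolynomial.induction_on with
  | C a => rw [← mul_one (C a), ← smul_eq_C_mul, map_smul, smul_mul_assoc, one_mul]
  | add p q hp hq => rw [map_add, hp, hq, add_mul]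
  | mul_X p i hp => rw [mul_comm, hφ, hp, mul_assoc]

theorem shiftS_zero : shiftS 0 = LinearMap.id := by
  have hvar : (fun i : Fin 2 => if i = 0 then (X 0 - C ((0 : ℤ) : ℂ) : R2) else X 1) = X := by
    funext i
    fin_cases i <;> simp
  unfold shiftS
  rw [hvar, aeval_X_left]
  rfl

theorem hpol_zero (b α : ℂ) (h : ℕ →₀ ℂ) : hpol b α h 0 = 0 := by
  simp [hpol, qpoly]

theorem PhiL_zero_apply (b lam α : ℂ) (h : ℕ →₀ ℂ) (f : R2) :
    PhiL b lam α h 0 f = X 0 * f := by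
  simp [PhiL, mulBy, shiftS_zero, hpol_zero]

theorem PhiW_zero_apply (b lam α : ℂ) (f : R2) : PhiW b lam α 0 f = X 1 * f := by
  simp [PhiW, mulBy, shiftS_zero, wcoef]

theorem PhiL_apply_C (b lam α : ℂ) (h : ℕ →₀ ℂ) (m : ℤ) (c : ℂ) :
    PhiL b lam α h m (C c) = C (lam ^ m) * (X 0 + hpol b α h m) * C c := by
  simp [PhiL, mulBy, shiftS, dT, algebraMap_eq, mul_assoc]

theorem PhiW_apply_C (b lam α : ℂ) (m : ℤ) (c : ℂ) :
    PhiW b lam α m (C c) = C (lam ^ m) * wcoef b α m * C c := by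
  simp [PhiW, mulBy, shiftS, algebraMap_eq, mul_assoc]

theorem wcoef_neg_one (α : ℂ) (m : ℤ) : wcoef (-1) α m = X 1 - C ((m : ℂ) * α) := by
  have hdlt : dlt (-1) 1 = 0 := if_neg (by norm_num)
  have hdlt_self : dlt (-1) (-1) = 1 := if_pos rfl
  simp [wcoef, hdlt, hdlt_self]

/-- the `W(0,−1)`-modules `Φ(λ,α,h)` and `Φ(μ,β,e)` are isomorphic
if and only if `λ = μ`, `α = β` and `h_n = e_n` for all `n ∈ ℤ`. -/
theorem stmt5 (lam mu : ℂ) (hlam : lam ≠ 0) (hmu : mu ≠ 0) (α β : ℂ) (h e : ℕ →₀ ℂ) :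
    (∃ φ : R2 ≃ₗ[ℂ] R2,
      (∀ m : ℤ, φ.toLinearMap ∘ₗ PhiL (-1) lam α h m = PhiL (-1) mu β e m ∘ₗ φ.toLinearMap) ∧
      (∀ m : ℤ, φ.toLinearMap ∘ₗ PhiW (-1) lam α m = PhiW (-1) mu β m ∘ₗ φ.toLinearMap))
      ↔ (lam = mu ∧ α = β ∧ ∀ n : ℤ, hpol (-1) α h n = hpol (-1) β e n) := by
  constructor
  · rintro ⟨φ, hL, hW⟩
    have hφX : ∀ i f, φ.toLinearMap (X i * f) = X i * φ.toLinearMap f := by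
      intro i f
      fin_cases i
      · simpa [PhiL_zero_apply] using LinearMap.congr_fun (hL 0) f
      · simpa [PhiW_zero_apply] using LinearMap.congr_fun (hW 0) f
    have hφ (f : R2) : φ f = f * φ 1 := linearMap_eq_mul_of_map_X_mul φ.toLinearMap hφX f
    have hunit : IsUnit (φ 1) := by
      obtain ⟨g, hg⟩ := φ.surjective 1
      exact IsUnit.of_mul_eq_one_right g ((hφ g).symm.trans hg)
    obtain ⟨c, -, hφ1⟩ := isUnit_iff_eq_C_of_isReduced.mp hunit
    have hC : (C c : R2) ≠ 0 := hφ1 ▸ hunit.ne_zero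
    have hL1 (m : ℤ) : C (lam ^ m) * (X 0 + hpol (-1) α h m) =
        C (mu ^ m) * (X 0 + hpol (-1) β e m) := by
      have := LinearMap.congr_fun (hL m) (C 1)
      simp only [LinearMap.comp_apply, LinearEquiv.coe_coe, PhiL_apply_C] at this
      rw [hφ, C_1, hφ1, PhiL_apply_C, mul_one] at this
      exact mul_right_cancel₀ hC this
    have hW1 : C lam * (X 1 - C α) = C mu * (X 1 - C β : R2) := by
      have := LinearMap.congr_fun (hW 1) (C 1)
      simp only [LinearMap.comp_apply, LinearEquiv.coe_coe, PhiW_apply_C] at this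
      rw [hφ, C_1, hφ1, PhiW_apply_C, mul_one] at this
      simpa [wcoef_neg_one] using mul_right_cancel₀ hC this
    have heval (x : ℂ) : lam * (x - α) = mu * (x - β) := by
      simpa using congrArg (eval fun _ => x) hW1
    obtain rfl : lam = mu := by linear_combination heval 1 - heval 0
    refine ⟨rfl, ?_, fun m => ?_⟩
    · simpa using mul_left_cancel₀ hlam (heval 0)
    · have hlm : (C (lam ^ m) : R2) ≠ 0 := by simpa using zpow_ne_zero m hlam
      exact add_left_cancel (mul_left_cancel₀ hlm (hL1 m))
  · rintro ⟨rfl, rfl, hpol_eq⟩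
    exact ⟨LinearEquiv.refl ℂ R2, fun m => by simp [PhiL, hpol_eq], fun m => by simp⟩
end
end
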